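/- arXiv:2407.01828 — 4 statements merged into one kernel-verified Lean document; each statement's English description precedes it below -/
import Mathlib

section
/- Let k ∈ ℕ, i ∈ ℤ and s an admissible symbol for index i (s ∈ S⁺ if i ≥ 0, s ∈ S⁻ if i < 0). Then the preimage of the cylinder C^s_i under the k-th iterate of the zip shift is: σ^{−k}(C^s_i) = C^s_{i+k} if i ∉ {−k, …, −1}, and σ^{−k}(C^s_i) = C^{φ⁻¹(s)}_{i+k} (the extended cylinder) if −k ≤ i ≤ −1. -/
open MeasureTheory Filter Real

namespace ZipShiftPaper

variable {Sm Sp : Type*}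

/-- `s` is an admissible symbol for index `i`: a negative symbol (inl) if `i < 0`,
a positive symbol (inr) if `i ≥ 0`. -/
def Adm (i : ℤ) (s : Sm ⊕ Sp) : Prop :=
  if i < 0 then s.isLeft = true else s.isRight = true

/-- The zip shift space: bilateral sequences with positive symbols on indices `≥ 0`
and negative symbols on indices `< 0`. -/
def ZipSpace (Sm Sp : Type*) := {x : ℤ → Sm ⊕ Sp // ∀ i, Adm i (x i)}

variable (φ : Sp → Sm)

/-- The transition function applied to a combined symbol. -/
def phiHat : Sm ⊕ Sp → Sm ⊕ Sp
  | .inl t => .inl t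
  | .inr s => .inl (φ s)

lemma adm_shift (x : ZipSpace Sm Sp) (i : ℤ) :
    Adm i (if i = -1 then phiHat φ (x.1 0) else x.1 (i + 1)) := by
  by_cases h : i = -1
  · subst h
    have h0 := x.2 0
    simp only [Adm, if_neg (by norm_num : ¬ (0:ℤ) < 0)] at h0
    simp only [if_pos rfl, Adm, if_pos (by norm_num : (-1:ℤ) < 0)]
    rcases hx : x.1 0 with t | s
    · rw [hx] at h0; simp at h0
    · simp [phiHat]
  · rw [if_neg h]
    have h1 := x.2 (i + 1)
    unfold Adm at h1 ⊢
    by_cases hi : i < 0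
    · rw [if_pos hi]; rw [if_pos (by omega)] at h1; exact h1
    · rw [if_neg hi]; rw [if_neg (by omega)] at h1; exact h1

/-- The zip shift map `σ_φ`. -/
def zipShift (x : ZipSpace Sm Sp) : ZipSpace Sm Sp :=
  ⟨fun i => if i = -1 then phiHat φ (x.1 0) else x.1 (i + 1), adm_shift φ x⟩

/-- The cylinder `C^s_i = {x : x_i = s}`. -/
def cyl (i : ℤ) (s : Sm ⊕ Sp) : Set (ZipSpace Sm Sp) := {x | x.1 i = s}

/-- The σ-algebra on the zip shift space, generated by the cylinders. -/
instance zipMS : MeasurableSpace (ZipSpace Sm Sp) :=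
  .generateFrom {C | ∃ i s, C = cyl i s}

/-- The partition `𝒞_i` of `Σ` by cylinders of index `i`. -/
def cylPart (i : ℤ) : Set (Set (ZipSpace Sm Sp)) :=
  {C | ∃ s : Sm ⊕ Sp, Adm i s ∧ C = cyl i s}

/-- Forward image of a partition: `f(P) = {f(A) : A ∈ P}`. -/
def pushPart {α : Type*} (f : α → α) (P : Set (Set α)) : Set (Set α) :=
  (Set.image f) '' P

/-- Pullback of a partition: `f⁻¹(P) = {f⁻¹(A) : A ∈ P}`. -/
def pullPart {α : Type*} (f : α → α) (P : Set (Set α)) : Set (Set α) :=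
  (Set.preimage f) '' P

/-- `σ^j(P)` for `j : ℤ`: forward image for `j ≥ 0`, preimage for `j < 0`. -/
def powPart {α : Type*} (f : α → α) (j : ℤ) (P : Set (Set α)) : Set (Set α) :=
  if 0 ≤ j then pushPart (f^[j.toNat]) P else pullPart (f^[(-j).toNat]) P

/-- Common refinement (correfinement) `⋁_{i ∈ t} P i` of a family of partitions:
all nonempty intersections of one element from each partition. -/
def corefine {α ι : Type*} (t : Set ι) (P : ι → Set (Set α)) : Set (Set α) :=
  {A | A.Nonempty ∧ ∃ g : ι → Set α, (∀ i ∈ t, g i ∈ P i) ∧ A = ⋂ i ∈ t, g i}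

/-- The partition `𝒞_{n,…,n'}` by cylinders of indices from `n` to `n'`. -/
def cylRange (n n' : ℤ) : Set (Set (ZipSpace Sm Sp)) :=
  corefine (Set.Icc n n') cylPart

/-- The `k`-th dynamical correfinement `⋁_{j=0}^{k-1} f^{-j}(P)`. -/
def dynRefine {α : Type*} (f : α → α) (P : Set (Set α)) (k : ℕ) : Set (Set α) :=
  corefine (Set.Iio k) (fun j : ℕ => pullPart (f^[j]) P)

/-- Entropy of a partition: `H_μ(P) = Σ_{A ∈ P} -μ(A) log μ(A)`. -/
noncomputable def partH {α : Type*} [MeasurableSpace α] (μ : Measure α)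
    (P : Set (Set α)) : ℝ :=
  ∑' A : P, Real.negMulLog ((μ (A : Set α)).toReal)

variable (pp : Sp → ℝ) [Fintype Sp] [DecidableEq Sm]

/-- The pushforward distribution `p⁻ = φ_* p⁺` on the negative symbols. -/
def pm (t : Sm) : ℝ := ∑ s ∈ Finset.univ.filter (fun s => φ s = t), pp s

/-- The weight of symbol `s` at coordinate `i`: `p⁺_s` for a positive symbol at `i ≥ 0`,
`p⁻_s` for a negative symbol at `i < 0`, and `0` for inadmissible pairs. -/
def wt : ℤ → Sm ⊕ Sp → ℝ
  | i, .inl t => if i < 0 then pm φ pp t else 0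
  | i, .inr s => if 0 ≤ i then pp s else 0

/-- `μ` is the product measure determined by `p⁺` (coordinates independent, coordinate `i`
distributed as `p⁺` for `i ≥ 0` and as `p⁻ = φ_* p⁺` for `i < 0`). -/
def IsProductMeasure (μ : Measure (ZipSpace Sm Sp)) : Prop :=
  ∀ (F : Finset ℤ) (c : ℤ → Sm ⊕ Sp),
    μ {x : ZipSpace Sm Sp | ∀ i ∈ F, x.1 i = c i}
      = ∏ i ∈ F, ENNReal.ofReal (wt φ pp i (c i))

/-- The fiber space `σ⁻¹(ε) = {σ⁻¹({x}) : x ∈ Σ}`: the partition of `Σ` into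
preimages of points, viewed as a type. -/
def Fib (φ : Sp → Sm) := {A : Set (ZipSpace Sm Sp) // ∃ x, A = zipShift φ ⁻¹' {x}}

/-- The natural projection `π : Σ → σ⁻¹(ε)`, `π(y) = σ⁻¹({σ(y)})`. -/
def fibProj (y : ZipSpace Sm Sp) : Fib φ :=
  ⟨zipShift φ ⁻¹' {zipShift φ y}, zipShift φ y, rfl⟩

/-- The quotient σ-algebra on `σ⁻¹(ε)`:
`Q` is measurable iff `π⁻¹(Q)` is measurable in `Σ`. -/
instance fibMS : MeasurableSpace (Fib φ) :=
  MeasurableSpace.map (fibProj φ) (zipMS)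

/-- `X̂ = {x̂ : x ∈ X}`, the set of fibers of points of `X`. -/
def hatSet (X : Set (ZipSpace Sm Sp)) : Set (Fib φ) :=
  {A | ∃ x ∈ X, A.1 = zipShift φ ⁻¹' {x}}

/-- The negative symbol `x_{-1}` of a point of the zip shift space. -/
def negSym (x : ZipSpace Sm Sp) : Sm :=
  (x.1 (-1)).getLeft (by
    have h := x.2 (-1)
    simpa [Adm, if_pos (by norm_num : (-1:ℤ) < 0)] using h)

/-- The preimage `x̂(s) = (…, x_{-2}; s, x_0, x_1, …)` of `x` under the zip shift,
determined by the choice of positive symbol `s ∈ φ⁻¹(x_{-1})` at coordinate `0`. -/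
def prePoint (x : ZipSpace Sm Sp) (s : Sp) : ZipSpace Sm Sp :=
  ⟨fun j => if j = 0 then .inr s else x.1 (j - 1), by
    intro j
    dsimp only
    by_cases h : j = 0
    · subst h
      simp [Adm]
    · rw [if_neg h]
      have h1 := x.2 (j - 1)
      unfold Adm at h1 ⊢
      by_cases hj : j < 0
      · rw [if_pos hj]; rw [if_pos (by omega)] at h1; exact h1
      · rw [if_neg hj]; rw [if_neg (by omega)] at h1; exact h1⟩

/-- The conditional measure `μ_{x̂}` on the fiber `x̂ = σ⁻¹({x})`, giving mass
`q^{x_{-1}}_s = p⁺_s / p⁻_{x_{-1}}` to the point `x̂(s)`, `s ∈ φ⁻¹(x_{-1})`. -/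
noncomputable def condMeas (x : ZipSpace Sm Sp) : Measure (ZipSpace Sm Sp) :=
  ∑ s ∈ Finset.univ.filter (fun s => φ s = negSym x),
    (ENNReal.ofReal (pp s / pm φ pp (negSym x))) • Measure.dirac (prePoint x s)

/-- The conditional measure attached to a fiber `A ∈ σ⁻¹(ε)`. -/
noncomputable def condMeasFib (A : Fib φ) : Measure (ZipSpace Sm Sp) :=
  condMeas φ pp A.2.choose

/-- The entropy `H_{μ_{x̂}}(ε|_{x̂})` of the restriction of the atomic partition to the
fiber `x̂`, with respect to the conditional measure `μ_{x̂}`. -/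
noncomputable def fibH (A : Fib φ) : ℝ :=
  ∑' y : A.1,
    Real.negMulLog ((condMeasFib φ pp A {(y : ZipSpace Sm Sp)}).toReal)

/-- The folding entropy `F(σ) = ∫ H_{μ_{x̂}}(ε|_{x̂}) dμ̂(x̂)`, where `μ̂ = π_* μ` is the
quotient measure on `σ⁻¹(ε)`. -/
noncomputable def foldH (μ : Measure (ZipSpace Sm Sp)) : ℝ :=
  ∫ A, fibH φ pp A ∂(μ.map (fibProj φ))

/-- A finite measurable partition (mod 0) of a probability space. -/
def IsFinPart {α : Type*} [MeasurableSpace α] (μ : Measure α) (P : Set (Set α)) : Prop :=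
  P.Finite ∧ (∀ A ∈ P, MeasurableSet A) ∧ P.Pairwise Disjoint ∧ μ (⋃₀ P) = 1


/-- The Kolmogorov–Sinai entropy: the supremum, over all finite measurable partitions `P`,
of the limits `h_μ(f, P) = lim_n H_μ(⋁_{j=0}^{n-1} f^{-j}P)/n`. -/
noncomputable def ksEntropy {α : Type*} [MeasurableSpace α] (μ : Measure α) (f : α → α) : ℝ :=
  sSup {h : ℝ | ∃ P : Set (Set α), IsFinPart μ P ∧
    Tendsto (fun n : ℕ => partH μ (dynRefine f P n) / n) atTop (nhds h)}


end ZipShiftPaper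

open ZipShiftPaper


/-- Coordinates of the iterates of the zip shift: `φ` is applied exactly at those negative
indices which are reached from a nonnegative one. -/
lemma ZipShiftPaper.iterate_zipShift_apply {Sm Sp : Type*} (φ : Sp → Sm) (k : ℕ)
    (x : ZipSpace Sm Sp) (i : ℤ) :
    ((zipShift φ)^[k] x).1 i =
      if -(k : ℤ) ≤ i ∧ i ≤ -1 then phiHat φ (x.1 (i + k)) else x.1 (i + k) := by
  induction k generalizing i with
  | zero =>
    rw [if_neg (by push_cast; omega)]
    simp
  | succ k ih =>
    rw [Function.iterate_succ_apply']
    change (if i = -1 then phiHat φ (((zipShift φ)^[k] x).1 0)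
      else ((zipShift φ)^[k] x).1 (i + 1)) = _
    rw [ih, ih, if_neg (show ¬(-(k : ℤ) ≤ 0 ∧ (0 : ℤ) ≤ -1) by omega)]
    have hk : i + ((k + 1 : ℕ) : ℤ) = i + 1 + k := by push_cast; ring
    rw [hk]
    by_cases hi : i = -1
    · subst hi
      rw [if_pos rfl, if_pos ⟨by push_cast; omega, le_rfl⟩]
      simp
    · rw [if_neg hi]
      exact if_congr (by push_cast; omega) rfl rfl

/-- The symbol of a point at a nonnegative index is a positive symbol. -/
lemma ZipShiftPaper.exists_apply_eq_inr {Sm Sp : Type*} (x : ZipSpace Sm Sp) {j : ℤ}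
    (hj : 0 ≤ j) : ∃ u : Sp, x.1 j = Sum.inr u := by
  have h := x.2 j
  rw [Adm, if_neg (not_lt.mpr hj)] at h
  exact Sum.isRight_iff.mp h

/-- action of `σ^{-k}` on cylinders. -/
theorem statement0 {Sm Sp : Type*} [Fintype Sm] [Fintype Sp] [Nonempty Sm] [Nonempty Sp]
    (φ : Sp → Sm) (hφ : Function.Surjective φ)
    (k : ℕ) (i : ℤ) (s : Sm ⊕ Sp) (hs : Adm i s) :
    (¬ (-(k : ℤ) ≤ i ∧ i ≤ -1) → (zipShift φ)^[k] ⁻¹' cyl i s = cyl (i + k) s) ∧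
    ((-(k : ℤ) ≤ i ∧ i ≤ -1) → ∀ t : Sm, s = Sum.inl t →
      (zipShift φ)^[k] ⁻¹' cyl i s
        = ⋃ s' ∈ {s' : Sp | φ s' = t}, cyl (i + k) (Sum.inr s')) := by
  constructor
  · intro hi
    ext x
    change ((zipShift φ)^[k] x).1 i = s ↔ x.1 (i + k) = s
    rw [iterate_zipShift_apply, if_neg hi]
  · rintro hi t rfl
    ext x
    obtain ⟨u, hu⟩ := exists_apply_eq_inr x (j := i + k) (by omega)
    simp [cyl, iterate_zipShift_apply, if_pos hi, hu, phiHat]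
end

section
/- The zip shift σ preserves the measure μ: for every measurable set M ⊆ Σ, μ(σ⁻¹(M)) = μ(M). -/
open MeasureTheory Filter Real

open ZipShiftPaper


namespace ZipShiftPaper

section Invariance

variable {Sm Sp : Type*}

lemma measurableSet_cyl (i : ℤ) (s : Sm ⊕ Sp) : MeasurableSet (cyl i s) :=
  MeasurableSpace.measurableSet_generateFrom ⟨i, s, rfl⟩

/-- The cylinder of sequences prescribed by `c` on the finite set of indices `F`. -/
def finCyl (F : Finset ℤ) (c : ℤ → Sm ⊕ Sp) : Set (ZipSpace Sm Sp) :=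
  {x | ∀ i ∈ F, x.1 i = c i}

lemma measurableSet_finCyl (F : Finset ℤ) (c : ℤ → Sm ⊕ Sp) : MeasurableSet (finCyl F c) := by
  have h : finCyl F c = ⋂ i ∈ F, cyl i (c i) := by
    ext x
    simp [finCyl, cyl]
  rw [h]
  exact F.measurableSet_biInter fun i _ => measurableSet_cyl i (c i)

lemma isPiSystem_finCyl :
    IsPiSystem {C : Set (ZipSpace Sm Sp) | ∃ F c, C = finCyl F c} := by
  rintro _ ⟨F, c, rfl⟩ _ ⟨G, d, rfl⟩ ⟨y, hyF, hyG⟩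
  refine ⟨F ∪ G, y.1, ?_⟩
  ext x
  constructor
  · rintro ⟨hF, hG⟩ i hi
    rcases Finset.mem_union.1 hi with hi | hi
    · rw [hF i hi, hyF i hi]
    · rw [hG i hi, hyG i hi]
  · intro hx
    exact ⟨fun i hi => (hx i (Finset.mem_union_left _ hi)).trans (hyF i hi),
      fun i hi => (hx i (Finset.mem_union_right _ hi)).trans (hyG i hi)⟩

lemma generateFrom_finCyl :
    (zipMS : MeasurableSpace (ZipSpace Sm Sp)) =
      .generateFrom {C | ∃ F c, C = finCyl F c} := by
  apply le_antisymm
  · refine MeasurableSpace.generateFrom_mono ?_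
    rintro _ ⟨i, s, rfl⟩
    exact ⟨{i}, fun _ => s, by ext x; simp [finCyl, cyl]⟩
  · refine MeasurableSpace.generateFrom_le ?_
    rintro _ ⟨F, c, rfl⟩
    exact measurableSet_finCyl F c

lemma measurable_zipShift [Finite Sm] [Finite Sp] (φ : Sp → Sm) :
    Measurable (zipShift φ) := by
  refine measurable_generateFrom ?_
  rintro _ ⟨i, s, rfl⟩
  by_cases hi : i = -1
  · have h : zipShift φ ⁻¹' cyl i s = ⋃ u ∈ {u | phiHat φ u = s}, cyl 0 u := by
      ext x
      simp [zipShift, cyl, hi]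
    rw [h]
    exact (Set.toFinite _).measurableSet_biUnion fun u _ => measurableSet_cyl 0 u
  · have h : zipShift φ ⁻¹' cyl i s = cyl (i + 1) s := by
      ext x
      simp [zipShift, cyl, hi]
    rw [h]
    exact measurableSet_cyl _ _

lemma zipShift_preimage_finCyl_of_notMem (φ : Sp → Sm) {F : Finset ℤ} (hF : -1 ∉ F)
    (c : ℤ → Sm ⊕ Sp) :
    zipShift φ ⁻¹' finCyl F c = finCyl (F.image (· + 1)) (fun j => c (j - 1)) := by
  ext x
  simp only [finCyl, zipShift, Set.mem_preimage, Set.mem_ofPred_eq, Finset.forall_mem_image,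
    add_sub_cancel_right]
  refine forall₂_congr fun i hi => ?_
  have hne : i ≠ -1 := fun h => hF (h ▸ hi)
  simp [hne]

lemma exists_inr_zero (x : ZipSpace Sm Sp) : ∃ s, x.1 0 = .inr s := by
  have h := x.2 0
  rw [Adm, if_neg (lt_irrefl _)] at h
  exact Sum.isRight_iff.1 h

variable [Fintype Sp] [DecidableEq Sm] (φ : Sp → Sm) (pp : Sp → ℝ)

lemma wt_add_one {i : ℤ} (hi : i ≠ -1) (s : Sm ⊕ Sp) : wt φ pp (i + 1) s = wt φ pp i s := by
  rcases s with t | s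
  · have h : i + 1 < 0 ↔ i < 0 := by omega
    simp [wt, h]
  · have h : 0 ≤ i + 1 ↔ 0 ≤ i := by omega
    simp [wt, h]

lemma prod_wt_image_add_one {F : Finset ℤ} (hF : -1 ∉ F) {c d : ℤ → Sm ⊕ Sp}
    (hd : ∀ i ∈ F, d (i + 1) = c i) :
    ∏ j ∈ F.image (· + 1), ENNReal.ofReal (wt φ pp j (d j)) =
      ∏ i ∈ F, ENNReal.ofReal (wt φ pp i (c i)) := by
  rw [Finset.prod_image (by simp)]
  refine Finset.prod_congr rfl fun i hi => ?_
  rw [hd i hi, wt_add_one φ pp (fun h => hF (h ▸ hi))]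

lemma zipShift_preimage_finCyl_insert {G : Finset ℤ} (hG : -1 ∉ G) {c : ℤ → Sm ⊕ Sp} {t : Sm}
    (ht : c (-1) = .inl t) :
    zipShift φ ⁻¹' finCyl (insert (-1) G) c =
      ⋃ s ∈ Finset.univ.filter (fun s => φ s = t),
        finCyl (insert 0 (G.image (· + 1)))
          (Function.update (fun j => c (j - 1)) 0 (.inr s)) := by
  ext x
  obtain ⟨s, hs⟩ := exists_inr_zero x
  have hne : ∀ i ∈ G, i ≠ -1 := fun i hi h => hG (h ▸ hi)
  have hne' : ∀ i ∈ G, i + 1 ≠ 0 := fun i hi h => hne i hi (by omega)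
  have key : (∀ i ∈ G, (zipShift φ x).1 i = c i) ↔ ∀ i ∈ G, x.1 (i + 1) = c i :=
    forall₂_congr fun i hi => by simp [zipShift, hne i hi]
  have key' (u : Sp) : (∀ i ∈ G, x.1 (i + 1) =
      Function.update (fun j => c (j - 1)) 0 (.inr u) (i + 1)) ↔
      ∀ i ∈ G, x.1 (i + 1) = c i :=
    forall₂_congr fun i hi => by simp [Function.update_of_ne (hne' i hi)]
  simp only [finCyl, Set.mem_preimage, Set.mem_ofPred_eq, Finset.forall_mem_insert, key,
    Set.mem_iUnion, Finset.forall_mem_image, key', Finset.mem_filter, Finset.mem_univ, true_and,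
    Function.update_self, hs, ht, exists_prop, Sum.inr.injEq]
  have h0 : (zipShift φ x).1 (-1) = .inl (φ s) := by simp [zipShift, hs, phiHat]
  rw [h0, Sum.inl.injEq]
  constructor
  · rintro ⟨h1, h2⟩
    exact ⟨s, h1, rfl, h2⟩
  · rintro ⟨u, h1, rfl, h2⟩
    exact ⟨h1, h2⟩

lemma measure_zipShift_preimage_finCyl (hpp : ∀ s, 0 ≤ pp s) {μ : Measure (ZipSpace Sm Sp)}
    (hμ : IsProductMeasure φ pp μ) (F : Finset ℤ) (c : ℤ → Sm ⊕ Sp) :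
    μ (zipShift φ ⁻¹' finCyl F c) = μ (finCyl F c) := by
  have hcyl (F : Finset ℤ) (c : ℤ → Sm ⊕ Sp) :
      μ (finCyl F c) = ∏ i ∈ F, ENNReal.ofReal (wt φ pp i (c i)) := hμ F c
  by_cases hF : -1 ∈ F
  · obtain ⟨G, hG, rfl⟩ : ∃ G, -1 ∉ G ∧ insert (-1) G = F :=
      ⟨F.erase (-1), Finset.notMem_erase _ _, Finset.insert_erase hF⟩
    have h0 : (0 : ℤ) ∉ G.image (· + 1) := by
      simp only [Finset.mem_image, not_exists, not_and]
      intro i hi h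
      exact hG ((show i = -1 by omega) ▸ hi)
    rcases hc : c (-1) with t | s
    · rw [zipShift_preimage_finCyl_insert φ hG hc, measure_biUnion_finset]
      · have hterm (s : Sp) : μ (finCyl (insert 0 (G.image (· + 1)))
            (Function.update (fun j => c (j - 1)) 0 (.inr s))) =
            ENNReal.ofReal (pp s) * ∏ i ∈ G, ENNReal.ofReal (wt φ pp i (c i)) := by
          rw [hcyl, Finset.prod_insert h0, prod_wt_image_add_one φ pp hG (c := c)]
          · simp [wt]
          · intro i hi
            have hne : i + 1 ≠ 0 := fun h => hG ((show i = -1 by omega) ▸ hi)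
            simp [Function.update_of_ne hne]
        simp only [hterm]
        rw [← Finset.sum_mul, hcyl, Finset.prod_insert hG, hc,
          ← ENNReal.ofReal_sum_of_nonneg fun s _ => hpp s]
        simp [wt, pm]
      · intro s _ u _ hsu
        refine Set.disjoint_left.2 fun x hxs hxu => hsu ?_
        have h1 := hxs 0 (Finset.mem_insert_self _ _)
        have h2 := hxu 0 (Finset.mem_insert_self _ _)
        rw [Function.update_self] at h1 h2
        exact Sum.inr_injective (h1.symm.trans h2)
      · exact fun s _ => measurableSet_finCyl _ _
    · have hempty : zipShift φ ⁻¹' finCyl (insert (-1) G) c = ∅ := by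
        refine Set.eq_empty_of_forall_notMem fun x hx => ?_
        have h := hx (-1) (Finset.mem_insert_self _ _)
        obtain ⟨u, hu⟩ := exists_inr_zero x
        simp [zipShift, hu, phiHat, hc] at h
      rw [hempty, measure_empty, hcyl, Finset.prod_insert hG, hc]
      simp [wt]
  · rw [zipShift_preimage_finCyl_of_notMem φ hF, hcyl, hcyl,
      prod_wt_image_add_one φ pp hF (c := c) (by simp)]

end Invariance

end ZipShiftPaper

/-- the zip shift preserves the product measure μ. -/
theorem statement2 {Sm Sp : Type*} [Fintype Sm] [Fintype Sp] [Nonempty Sm] [Nonempty Sp]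
    [DecidableEq Sm]
    (φ : Sp → Sm) (hφ : Function.Surjective φ)
    (pp : Sp → ℝ) (hpp : ∀ s, 0 ≤ pp s) (hsum : ∑ s, pp s = 1)
    (μ : Measure (ZipSpace Sm Sp)) (hμ : IsProductMeasure φ pp μ) :
    ∀ M : Set (ZipSpace Sm Sp), MeasurableSet M → μ (zipShift φ ⁻¹' M) = μ M := by
  have huniv : μ Set.univ = 1 := by simpa using hμ ∅ fun _ => .inr (Classical.arbitrary Sp)
  have : IsFiniteMeasure μ := ⟨by simp [huniv]⟩
  have hmap : μ.map (zipShift φ) = μ := by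
    refine ext_of_generate_finite _ generateFrom_finCyl isPiSystem_finCyl ?_ ?_
    · rintro _ ⟨F, c, rfl⟩
      rw [Measure.map_apply (measurable_zipShift φ) (measurableSet_finCyl F c),
        measure_zipShift_preimage_finCyl φ pp hpp hμ]
    · rw [Measure.map_apply (measurable_zipShift φ) .univ, Set.preimage_univ]
  intro M hM
  rw [← Measure.map_apply (measurable_zipShift φ) hM, hmap]
end

section
/- For all integers n ≥ 0 and n' ≥ 0 with n + n' ≥ 1, the entropy of the partition by cylinders with indices from −n to n'−1 satisfies H_μ(𝒞_{−n,…,n'−1}) = n·H_μ(𝒞_{−1}) + n'·H_μ(𝒞_0). -/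
open MeasureTheory Filter Real

open ZipShiftPaper

/-- The entropy of a product distribution is the sum of the entropies of its factors. -/
lemma sum_negMulLog_prod {ι S : Type*} [Fintype ι] [DecidableEq ι] [Fintype S]
    (p : ι → S → ℝ) (hp : ∀ i, ∑ s, p i s = 1) :
    ∑ w : ι → S, negMulLog (∏ i, p i (w i)) = ∑ i, ∑ s, negMulLog (p i s) := by
  have expand (w : ι → S) (F : Finset ι) :
      negMulLog (∏ i ∈ F, p i (w i))
        = ∑ i ∈ F, ∏ j ∈ F, if j = i then negMulLog (p j (w j)) else p j (w j) := by
    induction F using Finset.induction_on with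
    | empty => simp
    | insert a F ha ih =>
      rw [Finset.prod_insert ha, negMulLog_mul, ih, Finset.sum_insert ha,
        Finset.prod_insert ha, if_pos rfl, mul_comm, Finset.mul_sum]
      congr 1
      · congr 1
        refine Finset.prod_congr rfl fun j hj => ?_
        rw [if_neg (ne_of_mem_of_not_mem hj ha)]
      · refine Finset.sum_congr rfl fun i hi => ?_
        rw [Finset.prod_insert ha, if_neg (ne_of_mem_of_not_mem hi ha).symm]
  simp_rw [expand]
  rw [Finset.sum_comm]
  refine Finset.sum_congr rfl fun i _ => ?_
  rw [← Fintype.prod_sum fun j s => if j = i then negMulLog (p j s) else p j s,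
    Finset.prod_eq_single i]
  · simp
  · intro j _ hj
    simp [hj, hp]
  · simp

namespace ZipShiftPaper

section Weights

variable {Sm Sp : Type*} [Fintype Sp] [DecidableEq Sm] (φ : Sp → Sm) (pp : Sp → ℝ)

lemma sum_wt [Fintype Sm] (hsum : ∑ s, pp s = 1) (i : ℤ) : ∑ s, wt φ pp i s = 1 := by
  rcases lt_or_ge i 0 with hi | hi
  · simp [wt, hi, hi.not_ge, pm, Finset.sum_fiberwise, hsum]
  · simp [wt, hi, hi.not_gt, hsum]

lemma wt_nonneg (hpp : ∀ s, 0 ≤ pp s) (i : ℤ) (s : Sm ⊕ Sp) : 0 ≤ wt φ pp i s := by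
  rcases s with t | s <;> simp only [wt] <;> split_ifs
  exacts [Finset.sum_nonneg fun s _ => hpp s, le_rfl, hpp s, le_rfl]

lemma wt_eq_zero_of_not_adm {i : ℤ} {s : Sm ⊕ Sp} (h : ¬ Adm i s) : wt φ pp i s = 0 := by
  rcases s with t | s <;> by_cases hi : i < 0 <;> simp_all [Adm, wt]

/-- The coordinate distribution depends only on the sign of the index. -/
lemma wt_eq_of_sign (i : ℤ) : wt φ pp i = wt φ pp (if i < 0 then -1 else 0) := by
  funext s
  rcases s with t | s <;> by_cases hi : i < 0 <;> simp [wt, hi, not_le.2, not_lt.1]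

end Weights

section Cylinders

variable {Sm Sp : Type*}

lemma exists_extension [Nonempty Sm] [Nonempty Sp] {F : Finset ℤ} {w : F → Sm ⊕ Sp}
    (hw : ∀ i : F, Adm (i : ℤ) (w i)) : ∃ x : ZipSpace Sm Sp, ∀ i : F, x.1 i = w i := by
  classical
  obtain ⟨t⟩ := ‹Nonempty Sm›
  obtain ⟨s⟩ := ‹Nonempty Sp›
  refine ⟨⟨fun i => if h : i ∈ F then w ⟨i, h⟩ else if i < 0 then .inl t else .inr s,
    fun i => ?_⟩, fun i => by simp⟩
  dsimp only
  split_ifs with h hi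
  · exact hw ⟨i, h⟩
  · simp [Adm, hi]
  · simp [Adm, hi]

/-- The set of points whose restriction to `F` is the word `w`. -/
def wordCyl (F : Finset ℤ) (w : F → Sm ⊕ Sp) : Set (ZipSpace Sm Sp) := {x | ∀ i : F, x.1 i = w i}

lemma injOn_wordCyl [Nonempty Sm] [Nonempty Sp] (F : Finset ℤ) :
    Set.InjOn (wordCyl (Sm := Sm) (Sp := Sp) F) {w | ∀ i : F, Adm (i : ℤ) (w i)} := by
  intro w hw v _ hwv
  obtain ⟨x, hx⟩ := exists_extension (F := F) hw
  have hxv : x ∈ wordCyl F v := hwv ▸ (show x ∈ wordCyl F w from hx)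
  exact funext fun i => (hx i).symm.trans (hxv i)

lemma corefine_cylPart [Nonempty Sm] [Nonempty Sp] (F : Finset ℤ) :
    corefine (F : Set ℤ) (cylPart (Sm := Sm) (Sp := Sp))
      = wordCyl F '' {w | ∀ i : F, Adm (i : ℤ) (w i)} := by
  ext A
  constructor
  · rintro ⟨⟨x, hx⟩, g, hg, rfl⟩
    refine ⟨fun i => x.1 i, fun i => x.2 i, ?_⟩
    have hgx : ∀ i ∈ F, g i = cyl i (x.1 i) := by
      intro i hi
      obtain ⟨s, -, hs⟩ := hg i hi
      have hxi : x ∈ g i := Set.mem_iInter₂.1 hx i hi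
      rw [hs] at hxi ⊢
      rw [show x.1 i = s from hxi]
    ext y
    simp only [wordCyl, Set.mem_ofPred_eq, Set.mem_iInter, Finset.mem_coe, Subtype.forall]
    refine forall₂_congr fun i hi => ?_
    rw [hgx i hi]
    rfl
  · rintro ⟨w, hw, rfl⟩
    obtain ⟨x, hx⟩ := exists_extension hw
    refine ⟨⟨x, hx⟩, fun i => cyl i (x.1 i), fun i _ => ⟨x.1 i, x.2 i, rfl⟩, ?_⟩
    ext y
    simp only [wordCyl, cyl, Set.mem_ofPred_eq, Set.mem_iInter, Finset.mem_coe, Subtype.forall]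
    exact forall₂_congr fun i hi => by rw [hx ⟨i, hi⟩]

lemma corefine_singleton_cylPart [Nonempty Sm] [Nonempty Sp] (i : ℤ) :
    corefine {i} (cylPart (Sm := Sm) (Sp := Sp)) = cylPart i := by
  ext A
  constructor
  · rintro ⟨-, g, hg, rfl⟩
    simpa using hg i rfl
  · rintro ⟨s, hs, rfl⟩
    obtain ⟨x, hx⟩ := exists_extension (F := {i}) (w := fun _ => s)
      (fun j => by rwa [Finset.mem_singleton.1 j.2])
    refine ⟨⟨x, hx ⟨i, Finset.mem_singleton_self i⟩⟩, fun _ => cyl i s, ?_, by simp⟩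
    rintro j rfl
    exact ⟨s, hs, rfl⟩

end Cylinders

section Entropy

variable {Sm Sp : Type*} [Fintype Sp] [Nonempty Sm] [DecidableEq Sm]
  {φ : Sp → Sm} {pp : Sp → ℝ} {μ : Measure (ZipSpace Sm Sp)}

lemma IsProductMeasure.toReal_wordCyl (hμ : IsProductMeasure φ pp μ) (hpp : ∀ s, 0 ≤ pp s)
    (F : Finset ℤ) (w : F → Sm ⊕ Sp) :
    (μ (wordCyl F w)).toReal = ∏ i : F, wt φ pp i (w i) := by
  classical
  obtain ⟨t⟩ := ‹Nonempty Sm›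
  let c : ℤ → Sm ⊕ Sp := fun i => if h : i ∈ F then w ⟨i, h⟩ else .inl t
  have hc (i : F) : c i = w i := by simp [c]
  have hcyl : wordCyl F w = {x | ∀ i ∈ F, x.1 i = c i} := by
    ext x
    simp only [wordCyl, Set.mem_ofPred_eq, ← hc, Subtype.forall]
  rw [hcyl, hμ, ENNReal.toReal_prod, ← Finset.prod_coe_sort]
  exact Finset.prod_congr rfl fun i _ => by
    rw [hc, ENNReal.toReal_ofReal (wt_nonneg φ pp hpp _ _)]

/-- The entropy of a finite refinement of cylinder partitions is the sum of the entropies of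
the coordinate distributions. -/
lemma IsProductMeasure.partH_corefine [Fintype Sm] [Nonempty Sp] (hμ : IsProductMeasure φ pp μ)
    (hpp : ∀ s, 0 ≤ pp s) (hsum : ∑ s, pp s = 1) (F : Finset ℤ) :
    partH μ (corefine (F : Set ℤ) cylPart) = ∑ i ∈ F, ∑ s, negMulLog (wt φ pp i s) := by
  classical
  rw [partH, corefine_cylPart,
    tsum_image (fun A => negMulLog (μ A).toReal) (injOn_wordCyl F)]
  simp_rw [hμ.toReal_wordCyl hpp F]
  rw [tsum_subtype_eq_of_support_subset
      (f := fun w : F → Sm ⊕ Sp => negMulLog (∏ i : F, wt φ pp i (w i))), tsum_fintype,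
    sum_negMulLog_prod (fun (i : F) s => wt φ pp i s) fun i => sum_wt φ pp hsum i]
  · exact Finset.sum_coe_sort F fun i => ∑ s, negMulLog (wt φ pp i s)
  · intro w hw i
    by_contra hi
    have hprod : ∏ j : F, wt φ pp j (w j) = 0 :=
      Finset.prod_eq_zero (Finset.mem_univ i) (wt_eq_zero_of_not_adm φ pp hi)
    exact hw (by simp only [hprod, negMulLog_zero])

lemma IsProductMeasure.partH_cylPart [Fintype Sm] [Nonempty Sp] (hμ : IsProductMeasure φ pp μ)
    (hpp : ∀ s, 0 ≤ pp s) (hsum : ∑ s, pp s = 1) (i : ℤ) :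
    partH μ (cylPart i) = ∑ s, negMulLog (wt φ pp i s) := by
  rw [← corefine_singleton_cylPart, ← Finset.coe_singleton, hμ.partH_corefine hpp hsum,
    Finset.sum_singleton]

end Entropy

end ZipShiftPaper

/-- `H_μ(𝒞_{-n,…,n'-1}) = n·H_μ(𝒞_{-1}) + n'·H_μ(𝒞_0)`. -/
theorem statement7 {Sm Sp : Type*} [Fintype Sm] [Fintype Sp] [Nonempty Sm] [Nonempty Sp]
    [DecidableEq Sm]
    (φ : Sp → Sm) (hφ : Function.Surjective φ)
    (pp : Sp → ℝ) (hpp : ∀ s, 0 ≤ pp s) (hsum : ∑ s, pp s = 1)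
    (μ : Measure (ZipSpace Sm Sp)) (hμ : IsProductMeasure φ pp μ)
    (n n' : ℕ) (h : 1 ≤ n + n') :
    partH μ (cylRange (-(n : ℤ)) ((n' : ℤ) - 1))
      = (n : ℝ) * partH μ (cylPart (-1)) + (n' : ℝ) * partH μ (cylPart 0) := by
  rw [hμ.partH_cylPart hpp hsum, hμ.partH_cylPart hpp hsum, cylRange, ← Finset.coe_Icc,
    hμ.partH_corefine hpp hsum]
  have hsign (i : ℤ) : ∑ s, negMulLog (wt φ pp i s)
      = if i < 0 then ∑ s, negMulLog (wt φ pp (-1) s) else ∑ s, negMulLog (wt φ pp 0 s) := by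
    rw [wt_eq_of_sign]
    split_ifs <;> rfl
  have hneg : (Finset.Icc (-(n : ℤ)) (n' - 1)).filter (· < 0) = Finset.Ico (-(n : ℤ)) 0 := by
    ext i
    simp only [Finset.mem_filter, Finset.mem_Icc, Finset.mem_Ico]
    omega
  have hnonneg : (Finset.Icc (-(n : ℤ)) (n' - 1)).filter (¬ · < 0) = Finset.Ico 0 (n' : ℤ) := by
    ext i
    simp only [Finset.mem_filter, Finset.mem_Icc, Finset.mem_Ico]
    omega
  rw [Finset.sum_congr rfl fun i _ => hsign i, Finset.sum_ite]
  rw [hneg, hnonneg]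
  simp [-Fintype.sum_sum_type]
end

section
/- Let n ≥ 1 and k ≥ 2n, and let 𝒫_n := 𝒞_{−n,…,n−1} be the partition by cylinders with indices from −n to n−1. Then the k-th dynamical correfinement of 𝒫_n under the zip shift equals the partition by cylinders with indices from −n to n+k−2: ⋁_{j=0}^{k−1} σ^{−j}(𝒫_n) = 𝒞_{−n,…,n+k−2}. -/
open MeasureTheory Filter Real

namespace ZipShiftPaper

/-- `P` consists exactly of the nonempty classes `{y | r x y}`, each determined by any of its
points. Empty members of `P` are ignored. -/
def IsClassPart {α : Type*} (P : Set (Set α)) (r : α → α → Prop) : Prop :=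
  ∀ x B, (B ∈ P ∧ x ∈ B) ↔ B = {y | r x y}

lemma IsClassPart.pullPart {α : Type*} {P : Set (Set α)} {r : α → α → Prop}
    (h : IsClassPart P r) (f : α → α) :
    IsClassPart (pullPart f P) (fun x y => r (f x) (f y)) := by
  intro x B
  constructor
  · rintro ⟨⟨C, hC, rfl⟩, hx⟩
    rw [(h (f x) C).1 ⟨hC, hx⟩]
    rfl
  · rintro rfl
    obtain ⟨hP, hx⟩ := (h (f x) _).2 rfl
    exact ⟨⟨_, hP, rfl⟩, hx⟩

lemma IsClassPart.corefine {α ι : Type*} {t : Set ι} {P : ι → Set (Set α)}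
    {r : ι → α → α → Prop} (h : ∀ i ∈ t, IsClassPart (P i) (r i)) :
    IsClassPart (corefine t P) (fun x y => ∀ i ∈ t, r i x y) := by
  intro x B
  constructor
  · rintro ⟨⟨-, g, hg, rfl⟩, hx⟩
    simp only [Set.mem_iInter] at hx
    ext y
    simp only [Set.mem_iInter, Set.mem_ofPred_eq]
    refine forall₂_congr fun i hi => ?_
    rw [(h i hi x (g i)).1 ⟨hg i hi, hx i hi⟩]
    rfl
  · rintro rfl
    have hx : x ∈ {y | ∀ i ∈ t, r i x y} := fun i hi => ((h i hi x _).2 rfl).2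
    refine ⟨⟨⟨x, hx⟩, fun i => {y | r i x y}, fun i hi => ((h i hi x _).2 rfl).1, ?_⟩, hx⟩
    ext y
    simp

lemma corefine_eq_corefine {α ι κ : Type*} {t : Set ι} {P : ι → Set (Set α)}
    {u : Set κ} {Q : κ → Set (Set α)} {r s : α → α → Prop}
    (hP : IsClassPart (corefine t P) r) (hQ : IsClassPart (corefine u Q) s)
    (hrs : ∀ x y, r x y ↔ s x y) : corefine t P = corefine u Q := by
  obtain rfl : r = s := funext₂ fun x y => propext (hrs x y)
  ext A
  constructor
  · intro hA
    obtain ⟨x, hx⟩ := hA.1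
    exact ((hQ x A).2 ((hP x A).1 ⟨hA, hx⟩)).1
  · intro hA
    obtain ⟨x, hx⟩ := hA.1
    exact ((hP x A).2 ((hQ x A).1 ⟨hA, hx⟩)).1

lemma isClassPart_cylPart {Sm Sp : Type*} (i : ℤ) :
    IsClassPart (cylPart i : Set (Set (ZipSpace Sm Sp))) (fun x y => y.1 i = x.1 i) := by
  intro x B
  constructor
  · rintro ⟨⟨s, -, rfl⟩, hx⟩
    obtain rfl : x.1 i = s := hx
    rfl
  · rintro rfl
    exact ⟨⟨x.1 i, x.2 i, rfl⟩, rfl⟩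

lemma isClassPart_cylRange {Sm Sp : Type*} (a b : ℤ) :
    IsClassPart (cylRange a b : Set (Set (ZipSpace Sm Sp)))
      (fun x y => ∀ i ∈ Set.Icc a b, y.1 i = x.1 i) :=
  IsClassPart.corefine fun i _ => isClassPart_cylPart i

lemma zipShift_iterate_apply {Sm Sp : Type*} (φ : Sp → Sm) (x : ZipSpace Sm Sp) (j : ℕ)
    (i : ℤ) : ((zipShift φ)^[j] x).1 i =
      if i < 0 ∧ 0 ≤ i + j then phiHat φ (x.1 (i + j)) else x.1 (i + j) := by
  induction j generalizing i with
  | zero => rw [if_neg (by push_cast; omega)]; simp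
  | succ j ih =>
    rw [Function.iterate_succ_apply']
    change (if i = -1 then phiHat φ (((zipShift φ)^[j] x).1 0)
      else ((zipShift φ)^[j] x).1 (i + 1)) = _
    have e : i + ((j + 1 : ℕ) : ℤ) = i + 1 + j := by push_cast; ring
    rw [ih, ih, e]
    by_cases hi : i = -1
    · subst hi
      simp
    · rw [if_neg hi]
      exact if_congr (by omega) rfl rfl

end ZipShiftPaper

open ZipShiftPaper


/-- for `n ≥ 1` and `k ≥ 2n`, `𝒫_n^k = 𝒞_{-n,…,n+k-2}`. -/
theorem statement9 {Sm Sp : Type*} [Fintype Sm] [Fintype Sp] [Nonempty Sm] [Nonempty Sp]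
    (φ : Sp → Sm) (hφ : Function.Surjective φ)
    (n k : ℕ) (hn : 1 ≤ n) (hk : 2 * n ≤ k) :
    dynRefine (zipShift φ) (cylRange (-(n : ℤ)) ((n : ℤ) - 1)) k
      = (cylRange (-(n : ℤ)) ((n : ℤ) + (k : ℤ) - 2) : Set (Set (ZipSpace Sm Sp))) := by
  refine corefine_eq_corefine (IsClassPart.corefine fun j _ =>
    (isClassPart_cylRange (-(n : ℤ)) ((n : ℤ) - 1)).pullPart ((zipShift φ)^[j]))
    (isClassPart_cylRange _ _) fun x y => ⟨fun h m hm => ?_, fun h j hj i hi => ?_⟩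
  · rw [Set.mem_Icc] at hm
    rcases lt_or_ge m n with hmn | hmn
    · exact h 0 (Set.mem_Iio.2 (by omega)) m (Set.mem_Icc.2 (by omega))
    · have key := h (m - (n - 1)).toNat (Set.mem_Iio.2 (by omega)) (n - 1)
        (Set.mem_Icc.2 (by omega))
      have e : (n : ℤ) - 1 + ((m - (n - 1)).toNat : ℤ) = m := by omega
      rwa [zipShift_iterate_apply, zipShift_iterate_apply, if_neg (by omega),
        if_neg (by omega), e] at key
  · rw [Set.mem_Iio] at hj
    rw [Set.mem_Icc] at hi
    rw [zipShift_iterate_apply, zipShift_iterate_apply,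
      h (i + j) (Set.mem_Icc.2 (by omega))]
end
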